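/- Let k be an algebraically closed field, Q a strongly locally finite quiver and A = kQ its path category. If f : L → M is an irreducible monomorphism in mod A and L is a finite direct sum of indecomposable modules, then coker(f) is finitely presented. -/

import Mathlib

open CategoryTheory CategoryTheory.Limits

namespace Paper

variable (k : Type) [Field k]

section General

variable (A : Type) [Category.{0} A] [Preadditive A] [CategoryTheory.Linear k A]

/-- A spectroid over `k`: a (small) Hom-finite `k`-linear category in which every object
has a local endomorphism ring and distinct objects are not isomorphic. -/
class Spectroid : Prop where
  homFinite : ∀ a b : A, FiniteDimensional k (a ⟶ b)
  localEnd : ∀ a : A, IsLocalRing (End a)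
  skeletal : ∀ a b : A, (a ≅ b) → a = b

variable {A}

/-- `M` is a module over `A`, i.e. the functor `M : A ⥤ ModuleCat k` is additive and
`k`-linear on morphisms. -/
def IsMod (M : A ⥤ ModuleCat.{0} k) : Prop :=
  (∀ {a b : A} (f g : a ⟶ b), M.map (f + g) = M.map f + M.map g) ∧
  (∀ {a b : A} (r : k) (f : a ⟶ b), M.map (r • f) = r • M.map f)

/-- `M` is a locally finite dimensional module over `A`, i.e. an object of `mod A`. -/
def IsLfdMod (M : A ⥤ ModuleCat.{0} k) : Prop :=
  IsMod k M ∧ ∀ a : A, FiniteDimensional k (M.obj a)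

/-- The projective module `P_a = Hom_A(a, -)` at an object `a`. -/
noncomputable def ProjAt (a : A) : A ⥤ ModuleCat.{0} k :=
  (linearCoyoneda k A).obj (Opposite.op a)

/-- The injective module `I_a = D Hom_A(-, a)` at an object `a`. -/
noncomputable def InjAt (a : A) : A ⥤ ModuleCat.{0} k where
  obj b := ModuleCat.of k (Module.Dual k (b ⟶ a))
  map {b c} f := ModuleCat.ofHom (LinearMap.dualMap (Linear.leftComp k a f))
  map_id b := by
    have h : Linear.leftComp k a (𝟙 b) = LinearMap.id := by
      apply LinearMap.ext; intro g; simp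
    rw [h, LinearMap.dualMap_id]; rfl
  map_comp {b c d} f g := by
    have h : Linear.leftComp k a (f ≫ g) =
        (Linear.leftComp k a f).comp (Linear.leftComp k a g) := by
      apply LinearMap.ext; intro h; simp
    rw [h]; rfl

instance : HasFiniteBiproducts (A ⥤ ModuleCat.{0} k) :=
  CategoryTheory.Abelian.hasFiniteBiproducts

/-- `M` is finitely generated: there is an epimorphism `⊕_{i=1}^r P_{a_i} → M`. -/
def IsFG (M : A ⥤ ModuleCat.{0} k) : Prop :=
  ∃ (r : ℕ) (a : Fin r → A) (f : (⨁ fun i => ProjAt k (a i)) ⟶ M), Epi f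

/-- `M` is finitely presented: there is an epimorphism `⊕_{i=1}^r P_{a_i} → M` with
finitely generated kernel. -/
def IsFP (M : A ⥤ ModuleCat.{0} k) : Prop :=
  ∃ (r : ℕ) (a : Fin r → A) (f : (⨁ fun i => ProjAt k (a i)) ⟶ M),
    Epi f ∧ IsFG k (kernel f)

/-- `M` is finitely co-generated: there is a monomorphism `M → ⊕_{j=1}^s I_{b_j}`. -/
def IsFCG (M : A ⥤ ModuleCat.{0} k) : Prop :=
  ∃ (s : ℕ) (b : Fin s → A) (f : M ⟶ ⨁ fun j => InjAt k (b j)), Mono f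

/-- `M` is finitely co-presented: there is a monomorphism `M → ⊕_{j=1}^s I_{b_j}` with
finitely co-generated cokernel. -/
def IsFCP (M : A ⥤ ModuleCat.{0} k) : Prop :=
  ∃ (s : ℕ) (b : Fin s → A) (f : M ⟶ ⨁ fun j => InjAt k (b j)),
    Mono f ∧ IsFCG k (cokernel f)

/-- `f` is an irreducible morphism in `mod A`: it is neither a split mono nor a split epi,
and in any factorization `f = g ≫ h` through an object of `mod A`, `g` is a split mono
or `h` is a split epi. -/
def Irred {L M : A ⥤ ModuleCat.{0} k} (f : L ⟶ M) : Prop :=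
  ¬ IsSplitMono f ∧ ¬ IsSplitEpi f ∧
    ∀ ⦃X : A ⥤ ModuleCat.{0} k⦄, IsLfdMod k X →
      ∀ (g : L ⟶ X) (h : X ⟶ M), g ≫ h = f → IsSplitMono g ∨ IsSplitEpi h

/-- `M` is an indecomposable object of `mod A`: it is nonzero, and whenever `M ≅ X ⊞ Y`
with `X`, `Y` in `mod A`, one of `X`, `Y` is zero. -/
def Indec (M : A ⥤ ModuleCat.{0} k) : Prop :=
  ¬ IsZero M ∧ ∀ ⦃X Y : A ⥤ ModuleCat.{0} k⦄, IsLfdMod k X → IsLfdMod k Y →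
    (M ≅ X ⊞ Y) → IsZero X ∨ IsZero Y

/-- `0 → L →f M →g N → 0` is an almost split sequence in `mod A`. -/
structure AlmostSplitSeq {L M N : A ⥤ ModuleCat.{0} k} (f : L ⟶ M) (g : M ⟶ N) : Prop where
  mono : Mono f
  epi : Epi g
  zero : f ≫ g = 0
  exact : (ShortComplex.mk f g zero).Exact
  not_splitMono : ¬ IsSplitMono f
  not_splitEpi : ¬ IsSplitEpi g
  left_almost_split : ∀ ⦃X : A ⥤ ModuleCat.{0} k⦄, IsLfdMod k X →
    ∀ u : L ⟶ X, ¬ IsSplitMono u → ∃ v : M ⟶ X, f ≫ v = u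
  right_almost_split : ∀ ⦃X : A ⥤ ModuleCat.{0} k⦄, IsLfdMod k X →
    ∀ u : X ⟶ N, ¬ IsSplitEpi u → ∃ v : X ⟶ M, v ≫ g = u

/-- `M` is projective as an object of `mod A`. -/
def ProjInMod (M : A ⥤ ModuleCat.{0} k) : Prop :=
  ∀ ⦃X Y : A ⥤ ModuleCat.{0} k⦄, IsLfdMod k X → IsLfdMod k Y →
    ∀ (e : X ⟶ Y), Epi e → ∀ u : M ⟶ Y, ∃ t : M ⟶ X, t ≫ e = u

/-- `M` is injective as an object of `mod A`. -/
def InjInMod (M : A ⥤ ModuleCat.{0} k) : Prop :=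
  ∀ ⦃X Y : A ⥤ ModuleCat.{0} k⦄, IsLfdMod k X → IsLfdMod k Y →
    ∀ (m : X ⟶ Y), Mono m → ∀ u : X ⟶ M, ∃ t : Y ⟶ M, m ≫ t = u

/-- `h` is a (nonempty) composition of irreducible morphisms between indecomposable
objects of `mod A`. -/
inductive IrredChain : ∀ {X Y : A ⥤ ModuleCat.{0} k}, (X ⟶ Y) → Prop
  | single {X Y : A ⥤ ModuleCat.{0} k} (f : X ⟶ Y) :
      IsLfdMod k X → Indec k X → IsLfdMod k Y → Indec k Y → Irred k f → IrredChain f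
  | comp {X Y Z : A ⥤ ModuleCat.{0} k} (f : X ⟶ Y) (g : Y ⟶ Z) :
      IsLfdMod k X → Indec k X → Irred k f → IrredChain g → IrredChain (f ≫ g)

end General

section QuiverSection

variable (Q : Type) [Quiver.{0} Q]

/-- `Q` is locally finite: every vertex is the source of finitely many arrows and the
target of finitely many arrows. -/
def LocallyFinite : Prop :=
  ∀ x : Q, Finite (Σ y : Q, x ⟶ y) ∧ Finite (Σ y : Q, y ⟶ x)

/-- `Q` is interval finite: there are finitely many paths between any two vertices. -/
def IntervalFinite : Prop :=
  ∀ x y : Q, Finite (Quiver.Path x y)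

/-- `Q` is strongly locally finite: locally finite and interval finite. -/
def StronglyLocallyFinite : Prop :=
  LocallyFinite Q ∧ IntervalFinite Q

/-- `Q` is connected: nonempty, and any two vertices are joined by a walk. -/
def QuiverConnected : Prop :=
  Nonempty Q ∧ ∀ x y : Q,
    Nonempty (Quiver.Path (Quiver.Symmetrify.of.obj x) (Quiver.Symmetrify.of.obj y))

/-- The path category `kQ` of the quiver `Q`: the free `k`-linear category on the free
category on `Q`. -/
abbrev PathCat := CategoryTheory.Free k (Paths Q)

/-- A vertex of `Q`, seen as an object of the path category `kQ`. -/
noncomputable def vtx (x : Q) : PathCat k Q :=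
  (Free.embedding k (Paths Q)).obj ((Paths.of Q).obj x)

/-- An arrow of `Q`, seen as a morphism of the path category `kQ`. -/
noncomputable def arrHom {x y : Q} (α : x ⟶ y) : vtx k Q x ⟶ vtx k Q y :=
  (Free.embedding k (Paths Q)).map ((Paths.of Q).map α)

/-- The degree of a vertex of `Q`: the total number of arrows incident to it. -/
noncomputable def degree (x : Q) : ℕ :=
  Nat.card ((Σ y : Q, x ⟶ y) ⊕ (Σ y : Q, y ⟶ x))

/-- `M` belongs to `rrep(Q)`: it is the middle term of a short exact sequence
`0 → L → M → N → 0` with `L` finitely presented, `N` finitely co-presented, and only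
finitely many arrows `α` of `Q` satisfy `M(α) ≠ 0`, `L(α) = 0` and `N(α) = 0`. -/
def InRrep (M : PathCat k Q ⥤ ModuleCat.{0} k) : Prop :=
  ∃ (L N : PathCat k Q ⥤ ModuleCat.{0} k) (f : L ⟶ M) (g : M ⟶ N) (zero : f ≫ g = 0),
    Mono f ∧ Epi g ∧ (ShortComplex.mk f g zero).Exact ∧ IsFP k L ∧ IsFCP k N ∧
    Set.Finite {p : Σ (x : Q) (y : Q), x ⟶ y |
      M.map (arrHom k Q p.2.2) ≠ 0 ∧ L.map (arrHom k Q p.2.2) = 0 ∧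
      N.map (arrHom k Q p.2.2) = 0}

variable {Q}

/-- The vertices occurring in a path. -/
def InPath {x : Q} : ∀ {y : Q}, Quiver.Path x y → Q → Prop
  | _, Quiver.Path.nil, v => v = x
  | _, @Quiver.Path.cons _ _ _ _ c p _, v => v = c ∨ InPath p v

variable (Q)

/-- `Q` is a star quiver: it is obtained from a finite full convex subquiver `Γ` by
attaching finitely many rays and co-rays with no common vertices. -/
def IsStarQuiver : Prop :=
  ∃ (Γ S₁ S₂ : Set Q) (v : Q → ℕ → Q),
    Γ.Finite ∧ S₁ ⊆ Γ ∧ S₂ ⊆ Γ ∧ Disjoint S₁ S₂ ∧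
    (∀ x y : Q, x ∈ Γ → y ∈ Γ → ∀ p : Quiver.Path x y, ∀ z : Q, InPath p z → z ∈ Γ) ∧
    (∀ s ∈ S₁ ∪ S₂, ∀ i : ℕ, v s i ∉ Γ) ∧
    (∀ s ∈ S₁ ∪ S₂, ∀ t ∈ S₁ ∪ S₂, ∀ i j : ℕ, v s i = v t j → s = t ∧ i = j) ∧
    (∀ x : Q, x ∉ Γ → ∃ s ∈ S₁ ∪ S₂, ∃ i : ℕ, x = v s i) ∧
    (∀ s ∈ S₁, Nat.card (s ⟶ v s 0) = 1 ∧ ∀ i : ℕ, Nat.card (v s i ⟶ v s (i + 1)) = 1) ∧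
    (∀ s ∈ S₂, Nat.card (v s 0 ⟶ s) = 1 ∧ ∀ i : ℕ, Nat.card (v s (i + 1) ⟶ v s i) = 1) ∧
    (∀ x y : Q, (x ⟶ y) → ¬(x ∈ Γ ∧ y ∈ Γ) →
      (∃ s ∈ S₁, (x = s ∧ y = v s 0) ∨ ∃ i : ℕ, x = v s i ∧ y = v s (i + 1)) ∨
      (∃ s ∈ S₂, (x = v s 0 ∧ y = s) ∨ ∃ i : ℕ, x = v s (i + 1) ∧ y = v s i))

end QuiverSection

section Subfunctors

variable {k}
variable {A : Type} [Category.{0} A]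

lemma app_injective {M N : A ⥤ ModuleCat.{0} k} (f : M ⟶ N) [Mono f] (a : A) :
    Function.Injective (f.app a) :=
  (ModuleCat.mono_iff_injective (f.app a)).1 inferInstance

lemma app_surjective {M N : A ⥤ ModuleCat.{0} k} (f : M ⟶ N) [Epi f] (a : A) :
    Function.Surjective (f.app a) :=
  (ModuleCat.epi_iff_surjective (f.app a)).1 inferInstance

lemma epi_of_surjective {M N : A ⥤ ModuleCat.{0} k} (f : M ⟶ N)
    (h : ∀ a, Function.Surjective (f.app a)) : Epi f := by
  have : ∀ a, Epi (f.app a) := fun a => (ModuleCat.epi_iff_surjective (f.app a)).2 (h a)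
  exact NatTrans.epi_of_epi_app f

lemma naturality_elem {M N : A ⥤ ModuleCat.{0} k} (f : M ⟶ N) {a b : A} (h : a ⟶ b)
    (x : M.obj a) : f.app b (M.map h x) = N.map h (f.app a x) :=
  congr($(f.naturality h) x)

lemma hom_ext_elem {M N : A ⥤ ModuleCat.{0} k} {f g : M ⟶ N}
    (h : ∀ a (x : M.obj a), f.app a x = g.app a x) : f = g := by
  ext a x
  exact h a x

lemma eq_zero_of_isZero {M : A ⥤ ModuleCat.{0} k} (hM : IsZero M) {a : A} (x : M.obj a) : x = 0 :=
  congr(($(hM.eq_of_src (𝟙 M) 0)).app a x)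

/-- A subfunctor of `M`, given by a compatible family of subspaces. -/
structure SubRep (M : A ⥤ ModuleCat.{0} k) where
  /-- The subspace at `a`. -/
  carrier : ∀ a, Submodule k (M.obj a)
  map_mem : ∀ {a b : A} (h : a ⟶ b) {x : M.obj a}, x ∈ carrier a → M.map h x ∈ carrier b

namespace SubRep

variable {M N : A ⥤ ModuleCat.{0} k}

/-- The kernel of a natural transformation. -/
def ker (f : M ⟶ N) : SubRep M where
  carrier a := LinearMap.ker (f.app a).hom
  map_mem {a b} h x hx := by
    have hx : f.app a x = 0 := hx
    change f.app b (M.map h x) = 0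
    rw [naturality_elem, hx, map_zero]

lemma mem_ker {f : M ⟶ N} {a : A} {x : M.obj a} : x ∈ (ker f).carrier a ↔ f.app a x = 0 :=
  Iff.rfl

/-- The range of a natural transformation. -/
def range (f : M ⟶ N) : SubRep N where
  carrier a := LinearMap.range (f.app a).hom
  map_mem {a b} h x hx := by
    obtain ⟨y, rfl⟩ := hx
    exact ⟨M.map h y, naturality_elem f h y⟩

/-- The quotient of a functor by a subfunctor. -/
def quot (U : SubRep M) : A ⥤ ModuleCat.{0} k where
  obj a := ModuleCat.of k (M.obj a ⧸ U.carrier a)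
  map {a b} h := ModuleCat.ofHom
    (Submodule.mapQ _ _ (M.map h).hom (fun _ hx => U.map_mem h hx))
  map_id a := by
    ext x
    simp
  map_comp f g := by
    ext x
    simp

/-- The projection to the quotient. -/
def proj (U : SubRep M) : M ⟶ U.quot where
  app a := ModuleCat.ofHom (U.carrier a).mkQ
  naturality _ _ _ := rfl

lemma proj_surjective (U : SubRep M) (a : A) : Function.Surjective (U.proj.app a) :=
  Submodule.mkQ_surjective _

lemma proj_eq_zero_iff (U : SubRep M) {a : A} {x : M.obj a} :
    U.proj.app a x = 0 ↔ x ∈ U.carrier a :=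
  Submodule.Quotient.mk_eq_zero _

instance (U : SubRep M) : Epi U.proj := epi_of_surjective _ U.proj_surjective

/-- The map out of the quotient induced by a map vanishing on the subfunctor. -/
def desc (U : SubRep M) (f : M ⟶ N) (hf : ∀ a, ∀ x ∈ U.carrier a, f.app a x = 0) :
    U.quot ⟶ N where
  app a := ModuleCat.ofHom ((U.carrier a).liftQ (f.app a).hom (fun x hx => hf a x hx))
  naturality a b h := by
    ext x
    obtain ⟨x, rfl⟩ := Submodule.Quotient.mk_surjective _ x
    exact naturality_elem f h x

/-- A subfunctor, seen as a functor. -/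
def sub (U : SubRep M) : A ⥤ ModuleCat.{0} k where
  obj a := ModuleCat.of k (U.carrier a)
  map {a b} h := ModuleCat.ofHom ((M.map h).hom.restrict (fun _ hx => U.map_mem h hx))
  map_id a := by
    ext x
    have h : M.map (𝟙 a) x.1 = x.1 := by simp
    exact h
  map_comp f g := by
    ext x
    have h : M.map (f ≫ g) x.1 = M.map g (M.map f x.1) := by simp
    exact h

/-- The inclusion of a subfunctor. -/
def incl (U : SubRep M) : U.sub ⟶ M where
  app a := ModuleCat.ofHom (U.carrier a).subtype
  naturality _ _ _ := rfl

/-- The smallest subfunctor containing `U` at all objects of `S`. -/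
def gen (U : SubRep M) (S : Set A) : SubRep M where
  carrier a := ⨅ V : {V : SubRep M // ∀ s ∈ S, U.carrier s ≤ V.carrier s}, V.1.carrier a
  map_mem h x hx := by
    rw [Submodule.mem_iInf] at hx ⊢
    exact fun V => V.1.map_mem h (hx V)

lemma gen_le {U V : SubRep M} {S : Set A} (h : ∀ s ∈ S, U.carrier s ≤ V.carrier s) (a : A) :
    (U.gen S).carrier a ≤ V.carrier a :=
  iInf_le (fun V : {V : SubRep M // ∀ s ∈ S, U.carrier s ≤ V.carrier s} => V.1.carrier a) ⟨V, h⟩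

lemma gen_le_self (U : SubRep M) (S : Set A) (a : A) : (U.gen S).carrier a ≤ U.carrier a :=
  gen_le (fun _ _ => le_rfl) a

lemma le_gen (U : SubRep M) {S : Set A} {s : A} (hs : s ∈ S) :
    U.carrier s ≤ (U.gen S).carrier s :=
  le_iInf fun V => V.2 s hs

instance : Top (SubRep M) := ⟨{ carrier := fun _ => ⊤, map_mem := fun _ _ _ => trivial }⟩

lemma mem_top {a : A} (x : M.obj a) : x ∈ (⊤ : SubRep M).carrier a := trivial

end SubRep

/-- `M` is generated by its values at the objects of `S`. -/
def GeneratedAt (M : A ⥤ ModuleCat.{0} k) (S : Set A) : Prop :=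
  ∀ U : SubRep M, (∀ s ∈ S, ∀ x, x ∈ U.carrier s) → ∀ a x, x ∈ U.carrier a

lemma GeneratedAt.hom_ext {M N : A ⥤ ModuleCat.{0} k} {S : Set A} (hM : GeneratedAt M S)
    {f g : M ⟶ N} (h : ∀ s ∈ S, ∀ x, f.app s x = g.app s x) : f = g := by
  refine hom_ext_elem fun a x => sub_eq_zero.1 ?_
  exact hM (SubRep.ker (f - g)) (fun s hs x => by
    change f.app s x - g.app s x = 0
    rw [h s hs x, sub_self]) a x

lemma exists_preimage_cokernel {L M : A ⥤ ModuleCat.{0} k} (f : L ⟶ M) {a : A} {x : M.obj a}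
    (hx : (cokernel.π f).app a x = 0) : ∃ y, f.app a y = x := by
  have h0 : f ≫ (SubRep.range f).proj = 0 :=
    hom_ext_elem fun b y => (SubRep.proj_eq_zero_iff _).2 ⟨y, rfl⟩
  have h1 : cokernel.π f ≫ cokernel.desc f _ h0 = (SubRep.range f).proj := cokernel.π_desc _ _ _
  have h2 : (SubRep.range f).proj.app a x = 0 := by
    rw [← h1]
    change (cokernel.desc f _ h0).app a ((cokernel.π f).app a x) = 0
    rw [hx, map_zero]
  exact (SubRep.proj_eq_zero_iff _).1 h2

lemma cokernel_condition_elem {L M : A ⥤ ModuleCat.{0} k} (f : L ⟶ M) {a : A} (x : L.obj a) :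
    (cokernel.π f).app a (f.app a x) = 0 :=
  congr(($(cokernel.condition f)).app a x)

lemma exists_preimage_kernel {M N : A ⥤ ModuleCat.{0} k} (f : M ⟶ N) {a : A} {x : M.obj a}
    (hx : f.app a x = 0) : ∃ y, (kernel.ι f).app a y = x := by
  have h0 : (SubRep.ker f).incl ≫ f = 0 := hom_ext_elem fun b y => y.2
  have h1 : kernel.lift f _ h0 ≫ kernel.ι f = (SubRep.ker f).incl := kernel.lift_ι _ _ _
  exact ⟨(kernel.lift f _ h0).app a ⟨x, hx⟩, congr(($h1).app a ⟨x, hx⟩)⟩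

lemma kernel_condition_elem {M N : A ⥤ ModuleCat.{0} k} (f : M ⟶ N) {a : A}
    (x : (kernel f : A ⥤ ModuleCat.{0} k).obj a) :
    f.app a ((kernel.ι f).app a x) = 0 :=
  congr(($(kernel.condition f)).app a x)

/-- `r` is a retraction of `f` over the full subcategory on `S`. -/
def RetractionOn {L M : A ⥤ ModuleCat.{0} k} (f : L ⟶ M) (S : Set A)
    (r : ∀ a, M.obj a →ₗ[k] L.obj a) : Prop :=
  (∀ a ∈ S, ∀ x, r a (f.app a x) = x) ∧
    ∀ a ∈ S, ∀ b ∈ S, ∀ (h : a ⟶ b) (m : M.obj a), r b (M.map h m) = L.map h (r a m)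

lemma RetractionOn.mono {L M : A ⥤ ModuleCat.{0} k} {f : L ⟶ M} {S T : Set A} (hST : S ⊆ T)
    {r : ∀ a, M.obj a →ₗ[k] L.obj a} (h : RetractionOn f T r) : RetractionOn f S r :=
  ⟨fun a ha => h.1 a (hST ha), fun a ha b hb => h.2 a (hST ha) b (hST hb)⟩

section Biproduct

variable {r : ℕ} {X : Fin r → (A ⥤ ModuleCat.{0} k)}

lemma biproduct_total_elem (b : A) (x : (⨁ X : A ⥤ ModuleCat.{0} k).obj b) :
    ∑ i, (biproduct.ι X i).app b ((biproduct.π X i).app b x) = x := by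
  have h : (∑ i, biproduct.π X i ≫ biproduct.ι X i) = 𝟙 (⨁ X) := biproduct.total
  have h2 := congr(($h).app b x)
  rw [NatTrans.app_sum] at h2
  simpa using h2

lemma biproduct_elem_ext {b : A} {x y : (⨁ X : A ⥤ ModuleCat.{0} k).obj b}
    (h : ∀ i, (biproduct.π X i).app b x = (biproduct.π X i).app b y) : x = y := by
  rw [← biproduct_total_elem b x, ← biproduct_total_elem b y]
  simp_rw [h]

end Biproduct

end Subfunctors

section Modules

variable {k}
variable {A : Type} [Category.{0} A] [Preadditive A] [CategoryTheory.Linear k A]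

lemma IsMod.map_zero {M : A ⥤ ModuleCat.{0} k} (hM : IsMod k M) (a b : A) :
    M.map (0 : a ⟶ b) = 0 := by
  simpa using hM.1 (0 : a ⟶ b) 0

lemma IsMod.of_injective {M N : A ⥤ ModuleCat.{0} k} (hN : IsMod k N) (f : M ⟶ N)
    (hf : ∀ a, Function.Injective (f.app a)) : IsMod k M := by
  refine ⟨fun {a b} g h => ?_, fun {a b} r g => ?_⟩
  · ext x
    apply hf b
    change f.app b (M.map (g + h) x) = f.app b (M.map g x + M.map h x)
    rw [map_add, naturality_elem, naturality_elem, naturality_elem, hN.1]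
    rfl
  · ext x
    apply hf b
    change f.app b (M.map (r • g) x) = f.app b (r • M.map g x)
    rw [map_smul, naturality_elem, naturality_elem, hN.2]
    rfl

lemma IsMod.of_surjective {M N : A ⥤ ModuleCat.{0} k} (hM : IsMod k M) (f : M ⟶ N)
    (hf : ∀ a, Function.Surjective (f.app a)) : IsMod k N := by
  refine ⟨fun {a b} g h => ?_, fun {a b} r g => ?_⟩
  · ext x
    obtain ⟨x, rfl⟩ := hf a x
    change N.map (g + h) (f.app a x) = N.map g (f.app a x) + N.map h (f.app a x)
    rw [← naturality_elem, ← naturality_elem, ← naturality_elem, ← map_add, hM.1]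
    rfl
  · ext x
    obtain ⟨x, rfl⟩ := hf a x
    change N.map (r • g) (f.app a x) = r • N.map g (f.app a x)
    rw [← naturality_elem, ← naturality_elem, ← map_smul, hM.2]
    rfl

lemma IsLfdMod.of_injective {M N : A ⥤ ModuleCat.{0} k} (hN : IsLfdMod k N) (f : M ⟶ N)
    (hf : ∀ a, Function.Injective (f.app a)) : IsLfdMod k M := by
  refine ⟨hN.1.of_injective f hf, fun a => ?_⟩
  have := hN.2 a
  exact FiniteDimensional.of_injective (f.app a).hom (hf a)

lemma IsLfdMod.of_surjective {M N : A ⥤ ModuleCat.{0} k} (hM : IsLfdMod k M) (f : M ⟶ N)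
    (hf : ∀ a, Function.Surjective (f.app a)) : IsLfdMod k N := by
  refine ⟨hM.1.of_surjective f hf, fun a => ?_⟩
  have := hM.2 a
  exact Module.Finite.of_surjective (f.app a).hom (hf a)

lemma IsLfdMod.pullback {X Y Z : A ⥤ ModuleCat.{0} k} (hX : IsLfdMod k X) (hY : IsLfdMod k Y)
    (f : X ⟶ Z) (g : Y ⟶ Z) : IsLfdMod k (pullback f g) := by
  have hinj : ∀ (a : A) (x y : (Limits.pullback f g : A ⥤ ModuleCat.{0} k).obj a),
      (pullback.fst f g).app a x = (pullback.fst f g).app a y →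
      (pullback.snd f g).app a x = (pullback.snd f g).app a y → x = y := by
    intro a x y h₁ h₂
    have : Mono (pullback.fst f g ≫ biprod.inl + pullback.snd f g ≫ biprod.inr) :=
      ⟨fun u v h => pullback.hom_ext
        (by simpa using congr($h ≫ biprod.fst)) (by simpa using congr($h ≫ biprod.snd))⟩
    apply app_injective (pullback.fst f g ≫ biprod.inl + pullback.snd f g ≫ biprod.inr) a
    change (biprod.inl : X ⟶ X ⊞ Y).app a ((pullback.fst f g).app a x) +
        (biprod.inr : Y ⟶ X ⊞ Y).app a ((pullback.snd f g).app a x) =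
      (biprod.inl : X ⟶ X ⊞ Y).app a ((pullback.fst f g).app a y) +
        (biprod.inr : Y ⟶ X ⊞ Y).app a ((pullback.snd f g).app a y)
    rw [h₁, h₂]
  refine ⟨⟨fun {a b} p q => ?_, fun {a b} r p => ?_⟩, fun a => ?_⟩
  · ext x
    apply hinj
    · change _ = (pullback.fst f g).app b
        ((Limits.pullback f g).map p x + (Limits.pullback f g).map q x)
      rw [map_add, naturality_elem, naturality_elem, naturality_elem, hX.1.1]
      rfl
    · change _ = (pullback.snd f g).app b
        ((Limits.pullback f g).map p x + (Limits.pullback f g).map q x)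
      rw [map_add, naturality_elem, naturality_elem, naturality_elem, hY.1.1]
      rfl
  · ext x
    apply hinj
    · change _ = (pullback.fst f g).app b (r • (Limits.pullback f g).map p x)
      rw [map_smul, naturality_elem, naturality_elem, hX.1.2]
      rfl
    · change _ = (pullback.snd f g).app b (r • (Limits.pullback f g).map p x)
      rw [map_smul, naturality_elem, naturality_elem, hY.1.2]
      rfl
  · have := hX.2 a
    have := hY.2 a
    exact FiniteDimensional.of_injective
      (((pullback.fst f g).app a).hom.prod ((pullback.snd f g).app a).hom)
      (fun x y h => hinj a x y (congrArg Prod.fst h) (congrArg Prod.snd h))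

end Modules

section Compactness

variable {k}

lemma exists_dual_of_finite {V : Type*} [AddCommGroup V] [Module k V] (E : Set (V × k))
    (h : ∀ F : Finset (V × k), ↑F ⊆ E → ∃ φ : Module.Dual k V, ∀ p ∈ F, φ p.1 = p.2) :
    ∃ φ : Module.Dual k V, ∀ p ∈ E, φ p.1 = p.2 := by
  have hnot : ((0, 1) : V × k) ∉ Submodule.span k E := by
    intro hmem
    obtain ⟨T, hTE, hT⟩ := Submodule.mem_span_finite_of_mem_span hmem
    obtain ⟨φ, hφ⟩ := h T hTE
    have hle : Submodule.span k (T : Set (V × k)) ≤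
        LinearMap.ker (φ ∘ₗ LinearMap.fst k V k - LinearMap.snd k V k) :=
      Submodule.span_le.2 fun p hp => by simp [hφ p hp]
    simpa using hle hT
  obtain ⟨ψ, hψ, hE⟩ := Submodule.exists_le_ker_of_notMem hnot
  refine ⟨-(ψ (0, 1))⁻¹ • ψ ∘ₗ LinearMap.inl k V k, fun p hp => ?_⟩
  have h1 : ψ p = 0 := hE (Submodule.subset_span hp)
  have h2 : p = (p.1, 0) + p.2 • ((0, 1) : V × k) := by ext <;> simp
  rw [h2, map_add, map_smul, smul_eq_mul] at h1
  simp only [LinearMap.smul_apply, LinearMap.comp_apply, LinearMap.inl_apply, smul_eq_mul]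
  rw [eq_neg_of_add_eq_zero_left h1]
  field_simp

variable {A : Type} [Category.{0} A] [Preadditive A] [CategoryTheory.Linear k A]

/-- Locally finite dimensional modules are algebraically compact: a morphism out of such a module
splits as soon as it splits over all finite full subcategories. -/
lemma isSplitMono_of_retractionOn {L M : A ⥤ ModuleCat.{0} k} (hL : IsLfdMod k L) (f : L ⟶ M)
    (hf : ∀ S : Set A, S.Finite → ∃ r, RetractionOn f S r) : IsSplitMono f := by
  let I := Σ a : A, M.obj a × Module.Dual k (L.obj a)
  let Φ (r : ∀ a, M.obj a →ₗ[k] L.obj a) : Module.Dual k (I →₀ k) :=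
    Finsupp.linearCombination k fun t => t.2.2 (r t.1 t.2.1)
  have hΦ : ∀ r a m lam, Φ r (Finsupp.single ⟨a, m, lam⟩ 1) = lam (r a m) := fun r a m lam => by
    simp [Φ]
  let E : Set ((I →₀ k) × k) :=
    {p | ∃ S : Set A, S.Finite ∧ ∀ r, RetractionOn f S r → Φ r p.1 = p.2}
  obtain ⟨φ, hφ⟩ := exists_dual_of_finite E fun F hF => by
    choose! S hS hSr using fun p (hp : p ∈ F) => hF hp
    obtain ⟨r, hr⟩ := hf (⋃ p ∈ F, S p) (F.finite_toSet.biUnion hS)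
    exact ⟨Φ r, fun p hp => hSr p hp r (hr.mono (Set.subset_biUnion_of_mem (u := S) hp))⟩
  let B (a : A) : M.obj a →ₗ[k] Module.Dual k (L.obj a) →ₗ[k] k :=
    LinearMap.mk₂ k (fun m lam => φ (Finsupp.single ⟨a, m, lam⟩ 1))
      (fun m m' lam => by
        rw [← sub_eq_zero, ← map_add, ← map_sub]
        refine hφ (_, 0) ⟨∅, Set.finite_empty, fun r _ => ?_⟩
        simp [hΦ])
      (fun c m lam => by
        rw [← sub_eq_zero, ← map_smul, ← map_sub]
        refine hφ (_, 0) ⟨∅, Set.finite_empty, fun r _ => ?_⟩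
        rw [map_sub, map_smul, hΦ, hΦ]
        simp)
      (fun m lam lam' => by
        rw [← sub_eq_zero, ← map_add, ← map_sub]
        refine hφ (_, 0) ⟨∅, Set.finite_empty, fun r _ => ?_⟩
        simp [hΦ])
      (fun c m lam => by
        rw [← sub_eq_zero, ← map_smul, ← map_sub]
        refine hφ (_, 0) ⟨∅, Set.finite_empty, fun r _ => ?_⟩
        rw [map_sub, map_smul, hΦ, hΦ]
        simp)
  have hfin := hL.2
  let r (a : A) : M.obj a →ₗ[k] L.obj a := (Module.evalEquiv k (L.obj a)).symm.toLinearMap ∘ₗ B a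
  have hr : ∀ a m (lam : Module.Dual k (L.obj a)), lam (r a m) = φ (Finsupp.single ⟨a, m, lam⟩ 1) :=
    fun a m lam => by
      change Module.evalEquiv k (L.obj a) ((Module.evalEquiv k (L.obj a)).symm (B a m)) lam = _
      rw [LinearEquiv.apply_symm_apply]
      rfl
  have hext : ∀ a (x y : L.obj a), (∀ lam : Module.Dual k (L.obj a), lam x = lam y) → x = y :=
    fun a x y h => (Module.evalEquiv k (L.obj a)).injective (LinearMap.ext h)
  have hnat : ∀ (a b : A) (h : a ⟶ b) m, r b (M.map h m) = L.map h (r a m) := by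
    intro a b h m
    refine hext b _ _ fun lam => ?_
    have h1 := hr a m (lam ∘ₗ (L.map h).hom)
    refine Eq.trans ?_ h1.symm
    rw [hr, ← sub_eq_zero, ← map_sub]
    refine hφ (_, 0) ⟨{a, b}, by simp, fun r hr => ?_⟩
    rw [map_sub, hΦ, hΦ, hr.2 a (by simp) b (by simp)]
    exact sub_self _
  refine ⟨⟨⟨{ app := fun a => ModuleCat.ofHom (r a), naturality := fun a b h => ?_ }, ?_⟩⟩⟩
  · ext m
    exact hnat a b h m
  · refine hom_ext_elem fun a x => hext a _ _ fun lam => ?_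
    refine (hr a (f.app a x) lam).trans ?_
    refine hφ (_, lam x) ⟨{a}, by simp, fun r hr => ?_⟩
    refine (hΦ r a (f.app a x) lam).trans ?_
    rw [hr.1 a (by simp)]

end Compactness

section Projectives

variable {k}
variable {A : Type} [Category.{0} A] [Preadditive A] [CategoryTheory.Linear k A]

/-- The morphism `P_a ⟶ M` corresponding to an element of `M a`. -/
noncomputable def ofElem {M : A ⥤ ModuleCat.{0} k} (hM : IsMod k M) {a : A} (m : M.obj a) :
    ProjAt k a ⟶ M where
  app b := ModuleCat.ofHom (X := (a ⟶ b))
    { toFun := fun h => M.map h m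
      map_add' := fun g h => by rw [hM.1]; rfl
      map_smul' := fun r h => by rw [hM.2]; rfl }
  naturality b c h := by
    ext g
    exact congr($(M.map_comp g h) m)

/-- The canonical generator of `P_a`. -/
def projGen (a : A) : (ProjAt k a).obj a := 𝟙 a

lemma exists_map_projGen {a b : A} (x : (ProjAt k a).obj b) :
    ∃ h : a ⟶ b, (ProjAt k a).map h (projGen a) = x :=
  ⟨x, Category.id_comp (X := a) (Y := b) x⟩

lemma ofElem_projGen {M : A ⥤ ModuleCat.{0} k} (hM : IsMod k M) {a : A} (m : M.obj a) :
    (ofElem hM m).app a (projGen a) = m :=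
  congr($(M.map_id a) m)

section Biproduct

variable {r : ℕ} {X : Fin r → (A ⥤ ModuleCat.{0} k)}

lemma isLfdMod_biproduct (hX : ∀ i, IsLfdMod k (X i)) : IsLfdMod k (⨁ X) := by
  refine ⟨⟨fun {a b} g h => ?_, fun {a b} c g => ?_⟩, fun a => ?_⟩
  · ext x
    refine biproduct_elem_ext fun i => ?_
    change _ = (biproduct.π X i).app b ((⨁ X).map g x + (⨁ X).map h x)
    rw [map_add, naturality_elem, naturality_elem, naturality_elem, (hX i).1.1]
    rfl
  · ext x
    refine biproduct_elem_ext fun i => ?_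
    change _ = (biproduct.π X i).app b (c • (⨁ X).map g x)
    rw [map_smul, naturality_elem, naturality_elem, (hX i).1.2]
    rfl
  · have := fun i => (hX i).2 a
    exact FiniteDimensional.of_injective
      (LinearMap.pi fun i => ((biproduct.π X i).app a).hom)
      (fun x y h => biproduct_elem_ext fun i => congrFun h i)

end Biproduct

lemma isMod_projAt (a : A) : IsMod k (ProjAt k a) := by
  refine ⟨fun g h => ?_, fun r g => ?_⟩
  · ext x
    exact Preadditive.comp_add _ _ _ x g h
  · ext x
    exact CategoryTheory.Linear.comp_smul _ _ _ x r g

lemma generatedAt_biproduct_projAt {r : ℕ} {a : Fin r → A} {S : Set A} (ha : ∀ i, a i ∈ S) :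
    GeneratedAt (⨁ fun i => ProjAt k (a i)) S := by
  intro U hU b x
  rw [← biproduct_total_elem b x]
  refine Submodule.sum_mem _ fun i _ => ?_
  obtain ⟨h, hh⟩ := exists_map_projGen ((biproduct.π (fun i => ProjAt k (a i)) i).app b x)
  rw [← hh, naturality_elem]
  exact U.map_mem h (hU _ (ha i) _)

lemma exists_surjective_at {M : A ⥤ ModuleCat.{0} k} (hM : IsLfdMod k M) {S : Set A}
    (hS : S.Finite) :
    ∃ (r : ℕ) (a : Fin r → A) (φ : (⨁ fun i => ProjAt k (a i)) ⟶ M),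
      (∀ i, a i ∈ S) ∧ ∀ s ∈ S, Function.Surjective (φ.app s) := by
  have := hM.2
  have := hS.to_subtype
  let J := Σ s : S, Fin (Module.finrank k (M.obj s.1))
  have : Finite J := inferInstance
  let e : Fin (Nat.card J) ≃ J := (Finite.equivFin J).symm
  let m (j : J) : M.obj j.1.1 := Module.finBasis k (M.obj j.1.1) j.2
  let φ : (⨁ fun i => ProjAt k (e i).1.1) ⟶ M := biproduct.desc fun i => ofElem hM.1 (m (e i))
  have hφ : ∀ j, m j ∈ LinearMap.range (φ.app j.1.1).hom := by
    intro j
    obtain ⟨i, rfl⟩ := e.surjective j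
    have h : biproduct.ι (fun i => ProjAt k (e i).1.1) i ≫ φ = ofElem hM.1 (m (e i)) :=
      biproduct.ι_desc _ _
    refine ⟨(biproduct.ι (fun i => ProjAt k (e i).1.1) i).app _ (projGen _), ?_⟩
    exact congr(($h).app _ (projGen _)).trans (ofElem_projGen _ _)
  refine ⟨Nat.card J, fun i => (e i).1.1, φ, fun i => (e i).1.2, fun s hs => ?_⟩
  refine LinearMap.range_eq_top.1 (top_le_iff.1 ?_)
  rw [← (Module.finBasis k (M.obj s)).span_eq, Submodule.span_le]
  rintro _ ⟨t, rfl⟩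
  exact hφ ⟨⟨s, hs⟩, t⟩

end Projectives

section PathCategory

variable {k} {Q : Type} [Quiver.{0} Q]

lemma pathCat_hom_induction {x : Q} {P : ∀ {y : Q}, (vtx k Q x ⟶ vtx k Q y) → Prop}
    (id : P (𝟙 (vtx k Q x))) (zero : ∀ {y : Q}, P (0 : vtx k Q x ⟶ vtx k Q y))
    (comp : ∀ {y z : Q} (h : vtx k Q x ⟶ vtx k Q y) (α : y ⟶ z), P h → P (h ≫ arrHom k Q α))
    (add : ∀ {y : Q} (g h : vtx k Q x ⟶ vtx k Q y), P g → P h → P (g + h))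
    (smul : ∀ {y : Q} (c : k) (h : vtx k Q x ⟶ vtx k Q y), P h → P (c • h))
    {y : Q} (h : vtx k Q x ⟶ vtx k Q y) : P h := by
  have path : ∀ {y : Q} (p : Quiver.Path x y),
      P (show vtx k Q x ⟶ vtx k Q y from
        (Free.embedding k (Paths Q)).map (X := x) (Y := y) p) := by
    intro y p
    induction p with
    | nil => exact id
    | cons p α ih =>
      have h := comp _ α ih
      have e := (Free.embedding k (Paths Q)).map_comp (X := x) (Y := _) (Z := _) p
        ((Paths.of Q).map α)
      exact (congrArg P e).mpr h
  have single : ∀ {y : Q} (p : Quiver.Path x y) (c : k),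
      P (show vtx k Q x ⟶ vtx k Q y from (Finsupp.single p c : Quiver.Path x y →₀ k)) := by
    intro y p c
    have h := smul c _ (path p)
    have e : (Finsupp.single p c : Quiver.Path x y →₀ k) = c • Finsupp.single p 1 := by simp
    rw [e]
    exact h
  exact Finsupp.induction_linear (motive := fun h : Quiver.Path x y →₀ k =>
    P (show vtx k Q x ⟶ vtx k Q y from h)) h zero (fun g h hg hh => add _ _ hg hh)
    (fun p c => single p c)

/-- A natural transformation of modules over a path category, from a family of linear maps
compatible with arrows. -/
def natTransOfArrows {M N : PathCat k Q ⥤ ModuleCat.{0} k} (hM : IsMod k M) (hN : IsMod k N)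
    (t : ∀ x : Q, M.obj (vtx k Q x) →ₗ[k] N.obj (vtx k Q x))
    (ht : ∀ {x y : Q} (α : x ⟶ y) (m : M.obj (vtx k Q x)),
      t y (M.map (arrHom k Q α) m) = N.map (arrHom k Q α) (t x m)) : M ⟶ N where
  app x := ModuleCat.ofHom (t x)
  naturality := by
    suffices ∀ {x y : Q} (h : vtx k Q x ⟶ vtx k Q y) (m : M.obj (vtx k Q x)),
        t y (M.map h m) = N.map h (t x m) by
      intro x y h
      ext m
      exact this (x := x) (y := y) h m
    intro x y h
    refine pathCat_hom_induction
      (P := fun {y} h => ∀ m : M.obj (vtx k Q x), t y (M.map h m) = N.map h (t x m))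
      ?_ ?_ ?_ ?_ ?_ h
    · simp
    · intro y m
      rw [hM.map_zero, hN.map_zero]
      exact map_zero (t y)
    · intro y z h α hh m
      rw [Functor.map_comp, Functor.map_comp, ModuleCat.comp_apply, ModuleCat.comp_apply, ht, hh]
    · intro y g h hg hh m
      rw [hM.1, hN.1]
      change t y (M.map g m + M.map h m) = N.map g (t x m) + N.map h (t x m)
      rw [map_add, hg, hh]
    · intro y c h hh m
      rw [hM.2, hN.2]
      change t y (c • M.map h m) = c • N.map h (t x m)
      rw [map_smul, hh]

/-- A subfunctor of a module over a path category, from a family of subspaces stable under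
arrows. -/
def SubRep.ofArrows {M : PathCat k Q ⥤ ModuleCat.{0} k} (hM : IsMod k M)
    (U : ∀ x : Q, Submodule k (M.obj (vtx k Q x)))
    (hU : ∀ {x y : Q} (α : x ⟶ y) (m : M.obj (vtx k Q x)), m ∈ U x →
      M.map (arrHom k Q α) m ∈ U y) : SubRep M where
  carrier x := U x
  map_mem := by
    suffices ∀ {x y : Q} (h : vtx k Q x ⟶ vtx k Q y) (m : M.obj (vtx k Q x)), m ∈ U x →
        M.map h m ∈ U y from fun {x y} h {m} hm => this (x := x) (y := y) h m hm
    intro x y h m hm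
    refine pathCat_hom_induction
      (P := fun {y} h => M.map h m ∈ U y) ?_ ?_ ?_ ?_ ?_ h
    · simpa using hm
    · intro y
      rw [hM.map_zero]
      exact Submodule.zero_mem _
    · intro y z h α hh
      rw [Functor.map_comp, ModuleCat.comp_apply]
      exact hU α _ hh
    · intro y g h hg hh
      rw [hM.1]
      exact Submodule.add_mem _ hg hh
    · intro y c h hh
      rw [hM.2]
      exact Submodule.smul_mem _ c hh

/-- There is a function on the vertices which increases along all arrows whose source lies in the
support of `M`. -/
def Ranked (M : PathCat k Q ⥤ ModuleCat.{0} k) : Prop :=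
  ∃ rk : Q → ℕ, ∀ {y x : Q}, (y ⟶ x) → ∀ m : M.obj (vtx k Q y), m ≠ 0 → rk y < rk x

lemma Ranked.of_injective {M N : PathCat k Q ⥤ ModuleCat.{0} k} (hN : Ranked N) (f : M ⟶ N)
    (hf : ∀ a, Function.Injective (f.app a)) : Ranked M := by
  obtain ⟨rk, h⟩ := hN
  exact ⟨rk, fun {y x} α m hm => h α (f.app _ m) fun h0 => hm (hf _ (h0.trans (map_zero _).symm))⟩

lemma Ranked.of_surjective {M N : PathCat k Q ⥤ ModuleCat.{0} k} (hM : Ranked M) (f : M ⟶ N)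
    (hf : ∀ a, Function.Surjective (f.app a)) : Ranked N := by
  obtain ⟨rk, h⟩ := hM
  refine ⟨rk, fun {y x} α n hn => ?_⟩
  obtain ⟨m, rfl⟩ := hf _ n
  exact h α m fun h0 => hn (by rw [h0, map_zero])

lemma comp_arrHom_apply {x y z : Q} (h : vtx k Q x ⟶ vtx k Q y) (α : y ⟶ z) :
    (h ≫ arrHom k Q α : Quiver.Path x z →₀ k) =
      Finsupp.mapDomain (fun p : Quiver.Path x y => p.cons α) (h : Quiver.Path x y →₀ k) := by
  refine Finsupp.induction_linear (motive := fun h : Quiver.Path x y →₀ k =>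
    ((show vtx k Q x ⟶ vtx k Q y from h) ≫ arrHom k Q α : Quiver.Path x z →₀ k) =
      Finsupp.mapDomain (fun p : Quiver.Path x y => p.cons α) h) h ?_ ?_ ?_
  · rw [Finsupp.mapDomain_zero]
    exact zero_comp
  · intro g h hg hh
    rw [Finsupp.mapDomain_add, ← hg, ← hh]
    exact Preadditive.add_comp _ _ _ _ _ _
  · intro p c
    rw [Finsupp.mapDomain_single]
    refine (Free.single_comp_single k (C := Paths Q) (X := x) (Y := y) (Z := z) p
      ((Paths.of Q).map α) c 1).trans ?_
    rw [mul_one]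
    rfl

section ArrowFree

variable [∀ y : Q, Fintype (Σ z : Q, z ⟶ y)]

/-- For every vertex, the map from the sum of the spaces at the sources of the incoming arrows is
injective. -/
def ArrowFree (M : PathCat k Q ⥤ ModuleCat.{0} k) : Prop :=
  ∀ (y : Q) (u : ∀ p : Σ z : Q, z ⟶ y, M.obj (vtx k Q p.1)),
    ∑ p, M.map (arrHom k Q p.2) (u p) = 0 → ∀ p, u p = 0

lemma ArrowFree.of_injective {M N : PathCat k Q ⥤ ModuleCat.{0} k} (hN : ArrowFree N) (f : M ⟶ N)
    (hf : ∀ a, Function.Injective (f.app a)) : ArrowFree M := by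
  intro y u hu p
  refine hf _ ((hN y (fun p => f.app _ (u p)) ?_ p).trans (map_zero _).symm)
  simp_rw [← naturality_elem]
  rw [← map_sum, hu, map_zero]

lemma arrowFree_biproduct {r : ℕ} {X : Fin r → (PathCat k Q ⥤ ModuleCat.{0} k)}
    (hX : ∀ i, ArrowFree (X i)) : ArrowFree (⨁ X) := by
  intro y u hu p
  refine biproduct_elem_ext fun i => ?_
  refine (hX i y (fun p => (biproduct.π X i).app _ (u p)) ?_ p).trans (map_zero _).symm
  simp_rw [← naturality_elem]
  rw [← map_sum, hu, map_zero]

lemma sum_mapDomain_cons_eq_zero {x y : Q} (u : ∀ p : Σ z : Q, z ⟶ y, Quiver.Path x p.1 →₀ k)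
    (hu : ∑ p, Finsupp.mapDomain (fun q : Quiver.Path x p.1 => q.cons p.2) (u p) = 0)
    (p : Σ z : Q, z ⟶ y) : u p = 0 := by
  ext q
  have h := DFunLike.congr_fun hu (q.cons p.2)
  rw [Finsupp.finsetSum_apply, Finset.sum_eq_single p, Finsupp.mapDomain_apply] at h
  · exact h
  · intro q q' hq
    simpa using hq
  · intro p' _ hp
    refine Finsupp.mapDomain_of_notMem_range _ _ fun ⟨q', hq⟩ => hp ?_
    obtain ⟨z, α⟩ := p
    obtain ⟨z', α'⟩ := p'
    simp only [Quiver.Path.cons.injEq] at hq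
    obtain ⟨rfl, -, hq⟩ := hq
    rw [eq_of_heq hq]
  · simp

lemma arrowFree_projAt (x : Q) : ArrowFree (ProjAt k (vtx k Q x)) := by
  intro y u hu
  refine sum_mapDomain_cons_eq_zero u (Eq.trans ?_ hu)
  exact Finset.sum_congr rfl fun (p : Σ z : Q, z ⟶ y) _ =>
    (comp_arrHom_apply (x := x) (y := p.1) (z := y) (u p) p.2).symm

/-- A surjection onto an arrow-free ranked module splits. -/
lemma ArrowFree.exists_section {X N : PathCat k Q ⥤ ModuleCat.{0} k} (hX : IsMod k X)
    (hN : IsMod k N) (hfree : ArrowFree N) (hrk : Ranked N) (e : X ⟶ N)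
    (he : ∀ a, Function.Surjective (e.app a)) : ∃ σ : N ⟶ X, σ ≫ e = 𝟙 N := by
  classical
  obtain ⟨rk, hrk⟩ := hrk
  let σ : ∀ x : Q, N.obj (vtx k Q x) →ₗ[k] X.obj (vtx k Q x) :=
    (measure rk).wf.fix fun x ih =>
      if h : ∃ τ : N.obj (vtx k Q x) →ₗ[k] X.obj (vtx k Q x), (∀ n, e.app _ (τ n) = n) ∧
        ∀ (y : Q) (α : y ⟶ x) (hy : rk y < rk x) (n : N.obj (vtx k Q y)),
          τ (N.map (arrHom k Q α) n) = X.map (arrHom k Q α) (ih y hy n)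
      then h.choose else 0
  have hσ : ∀ x, (∀ n, e.app _ (σ x n) = n) ∧ ∀ (y : Q) (α : y ⟶ x), rk y < rk x →
      ∀ n : N.obj (vtx k Q y),
        σ x (N.map (arrHom k Q α) n) = X.map (arrHom k Q α) (σ y n) := by
    intro x
    induction x using (measure rk).wf.induction with
    | _ x ih =>
    have h : ∃ τ : N.obj (vtx k Q x) →ₗ[k] X.obj (vtx k Q x), (∀ n, e.app _ (τ n) = n) ∧
        ∀ (y : Q) (α : y ⟶ x), rk y < rk x → ∀ (n : N.obj (vtx k Q y)),
          τ (N.map (arrHom k Q α) n) = X.map (arrHom k Q α) (σ y n) := by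
      let j : (∀ p : Σ z : Q, z ⟶ x, N.obj (vtx k Q p.1)) →ₗ[k] N.obj (vtx k Q x) :=
        ∑ p : (Σ z : Q, z ⟶ x), (N.map (arrHom k Q p.2)).hom ∘ₗ LinearMap.proj p
      have hj : ∀ u, j u = ∑ p, N.map (arrHom k Q p.2) (u p) := fun u => by
        simp [j]
      let t : (∀ p : Σ z : Q, z ⟶ x, N.obj (vtx k Q p.1)) →ₗ[k] X.obj (vtx k Q x) :=
        ∑ p : (Σ z : Q, z ⟶ x), (X.map (arrHom k Q p.2)).hom ∘ₗ σ p.1 ∘ₗ LinearMap.proj p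
      have ht : ∀ u, t u = ∑ p, X.map (arrHom k Q p.2) (σ p.1 (u p)) := fun u => by
        simp [t]
      have hz : ∀ (y : Q), (y ⟶ x) → ¬ rk y < rk x → ∀ n : N.obj (vtx k Q y), n = 0 :=
        fun y α hy n => by_contra fun hn => hy (hrk α n hn)
      have het : ∀ u, e.app _ (t u) = j u := fun u => by
        rw [ht, hj, map_sum]
        refine Finset.sum_congr rfl fun (p : Σ z : Q, z ⟶ x) _ => ?_
        rw [naturality_elem]
        by_cases hp : rk p.1 < rk x
        · rw [(ih p.1 hp).1]
        · rw [hz p.1 p.2 hp (u p)]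
          simp
      have hker : LinearMap.ker j = ⊥ :=
        (Submodule.eq_bot_iff _).2 fun u hu => funext (hfree x u ((hj u).symm.trans hu))
      obtain ⟨ρ, hρ⟩ := j.exists_leftInverse_of_injective hker
      obtain ⟨s, hs⟩ := (e.app (vtx k Q x)).hom.exists_rightInverse_of_surjective
        (LinearMap.range_eq_top.2 (he _))
      have hs' : ∀ n, e.app _ (s n) = n := fun n => LinearMap.congr_fun hs n
      have hρ' : ∀ u, ρ (j u) = u := fun u => LinearMap.congr_fun hρ u
      refine ⟨s + (t - s ∘ₗ j) ∘ₗ ρ, fun n => ?_, fun y α hy n => ?_⟩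
      · change e.app _ (s n + (t (ρ n) - s (j (ρ n)))) = n
        rw [map_add, map_sub, hs', hs', het, sub_self, add_zero]
      · have h1 : N.map (arrHom k Q α) n = j (Pi.single ⟨y, α⟩ n) := by
          rw [hj, Finset.sum_eq_single ⟨y, α⟩ (fun p _ hp => by rw [Pi.single_eq_of_ne hp, map_zero])
            (by simp), Pi.single_eq_same]
        have h2 : t (Pi.single ⟨y, α⟩ n) = X.map (arrHom k Q α) (σ y n) := by
          rw [ht, Finset.sum_eq_single ⟨y, α⟩ (fun p _ hp => by
            rw [Pi.single_eq_of_ne hp, map_zero, map_zero]) (by simp), Pi.single_eq_same]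
        rw [h1, ← h2]
        change s (j _) + (t (ρ (j _)) - s (j (ρ (j _)))) = _
        rw [hρ']
        abel
    have hfix : σ x = h.choose := by
      have := (measure rk).wf.fix_eq (C := fun x => N.obj (vtx k Q x) →ₗ[k] X.obj (vtx k Q x))
        (fun x ih =>
          if h : ∃ τ : N.obj (vtx k Q x) →ₗ[k] X.obj (vtx k Q x), (∀ n, e.app _ (τ n) = n) ∧
            ∀ (y : Q) (α : y ⟶ x) (hy : rk y < rk x) (n : N.obj (vtx k Q y)),
              τ (N.map (arrHom k Q α) n) = X.map (arrHom k Q α) (ih y hy n)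
          then h.choose else 0) x
      exact this.trans (dif_pos h)
    rw [hfix]
    exact h.choose_spec
  refine ⟨natTransOfArrows hN hX σ fun {y x} α n => ?_, hom_ext_elem fun x n => (hσ x).1 n⟩
  by_cases hn : n = 0
  · simp [hn]
  · exact (hσ x).2 y α (hrk α n hn) n

/-- If the sources of the arrows into `S` are already taken care of, then the quotient of `K` by
the subfunctor generated at `S` is arrow-free. -/
lemma ArrowFree.mem_gen {M : PathCat k Q ⥤ ModuleCat.{0} k} (hM : IsMod k M) (hfree : ArrowFree M)
    (K : SubRep M) (S : Set (PathCat k Q))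
    (hS : ∀ {y x : Q}, (y ⟶ x) → vtx k Q x ∈ S →
      ∀ m ∈ K.carrier (vtx k Q y), m ∈ (K.gen S).carrier (vtx k Q y))
    {x : Q} (u : ∀ p : Σ z : Q, z ⟶ x, M.obj (vtx k Q p.1))
    (hu : ∀ p, u p ∈ K.carrier _)
    (hsum : ∑ p, M.map (arrHom k Q p.2) (u p) ∈ (K.gen S).carrier (vtx k Q x)) (p) :
    u p ∈ (K.gen S).carrier _ := by
  classical
  by_cases hx : vtx k Q x ∈ S
  · exact hS p.2 hx _ (hu p)
  let V : SubRep M := SubRep.ofArrows hM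
    (fun (x : Q) =>
      { carrier := {m | m ∈ (K.gen S).carrier (vtx k Q x) ∧ (vtx k Q x ∈ S ∨
          ∃ v : ∀ p : Σ z : Q, z ⟶ x, M.obj (vtx k Q p.1), (∀ p, v p ∈ (K.gen S).carrier _) ∧
            ∑ p, M.map (arrHom k Q p.2) (v p) = m)}
        add_mem' := by
          rintro m n ⟨hm, hm'⟩ ⟨hn, hn'⟩
          refine ⟨Submodule.add_mem _ hm hn, ?_⟩
          rcases hm' with h | ⟨v, hv, rfl⟩
          · exact Or.inl h
          rcases hn' with h | ⟨w, hw, rfl⟩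
          · exact Or.inl h
          refine Or.inr ⟨v + w, fun p => Submodule.add_mem _ (hv p) (hw p), ?_⟩
          simp [Finset.sum_add_distrib]
        zero_mem' := ⟨Submodule.zero_mem _, Or.inr ⟨0, fun p => Submodule.zero_mem _, by simp⟩⟩
        smul_mem' := by
          rintro c m ⟨hm, hm'⟩
          refine ⟨Submodule.smul_mem _ c hm, ?_⟩
          rcases hm' with h | ⟨v, hv, rfl⟩
          · exact Or.inl h
          refine Or.inr ⟨c • v, fun p => Submodule.smul_mem _ c (hv p), ?_⟩
          simp [Finset.smul_sum] })
    (fun {y x} α m hm => ⟨(K.gen S).map_mem _ hm.1, Or.inr ⟨Pi.single ⟨y, α⟩ m, fun p => by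
        by_cases hp : p = ⟨y, α⟩
        · subst hp
          rw [Pi.single_eq_same]
          exact hm.1
        · rw [Pi.single_eq_of_ne hp]
          exact Submodule.zero_mem _, by
        rw [Finset.sum_eq_single ⟨y, α⟩ (fun p _ hp => by rw [Pi.single_eq_of_ne hp, map_zero])
            (by simp), Pi.single_eq_same]⟩⟩)
  have hV : _ ∧ (vtx k Q x ∈ S ∨
      ∃ v : ∀ p : Σ z : Q, z ⟶ x, M.obj (vtx k Q p.1), (∀ p, v p ∈ (K.gen S).carrier _) ∧
        ∑ p, M.map (arrHom k Q p.2) (v p) = ∑ p, M.map (arrHom k Q p.2) (u p)) :=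
    SubRep.gen_le (U := K) (V := V) (S := S)
    (fun s hs m hm => ⟨K.le_gen hs hm, Or.inl hs⟩) (vtx k Q x) hsum
  obtain ⟨v, hv, hvu⟩ := hV.2.resolve_left hx
  have h0 := hfree x (u - v) (by
    simp only [Pi.sub_apply, map_sub, Finset.sum_sub_distrib]
    rw [hvu, sub_self]) p
  rw [sub_eq_zero.1 h0]
  exact hv p

end ArrowFree

end PathCategory

section Abelian

variable {C : Type*} [Category* C] [Abelian C]

lemma exists_comp_cokernel_of_isSplitMono {L M T : C} (f : L ⟶ M) [Mono f] (v : T ⟶ cokernel f)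
    (h : IsSplitMono (pullback.lift f 0 (by simp) : L ⟶ pullback (cokernel.π f) v)) :
    ∃ θ : T ⟶ M, θ ≫ cokernel.π f = v := by
  set f' : L ⟶ pullback (cokernel.π f) v := pullback.lift f 0 (by simp)
  have hker : (kernel.ι (pullback.snd (cokernel.π f) v) ≫ pullback.fst _ _) ≫
      cokernel.π f = 0 := by
    rw [Category.assoc, pullback.condition, kernel.condition_assoc, zero_comp]
  have hl : kernel.ι (pullback.snd (cokernel.π f) v) = Abelian.monoLift f _ hker ≫ f' :=
    pullback.hom_ext
      (by rw [Category.assoc, pullback.lift_fst, Abelian.monoLift_comp])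
      (by rw [Category.assoc, pullback.lift_snd, kernel.condition, comp_zero])
  have hq : kernel.ι (pullback.snd (cokernel.π f) v) ≫ (𝟙 _ - retraction f' ≫ f') = 0 := by
    rw [hl, Preadditive.comp_sub, Category.comp_id, Category.assoc, IsSplitMono.id_assoc, sub_self]
  have hτ : Abelian.epiDesc (pullback.snd (cokernel.π f) v) _ hq ≫ pullback.snd _ _ = 𝟙 T := by
    rw [← cancel_epi (pullback.snd (cokernel.π f) v), ← Category.assoc, Abelian.comp_epiDesc,
      Preadditive.sub_comp, Category.assoc, pullback.lift_snd, comp_zero, sub_zero,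
      Category.id_comp, Category.comp_id]
  refine ⟨Abelian.epiDesc (pullback.snd (cokernel.π f) v) _ hq ≫ pullback.fst _ _, ?_⟩
  rw [Category.assoc, pullback.condition, ← Category.assoc, hτ, Category.id_comp]

/-- The decomposition of `X` induced by a split epimorphism. -/
noncomputable def isoKernelBiprod {X N : C} (e : X ⟶ N) (σ : N ⟶ X) (hσ : σ ≫ e = 𝟙 N) :
    X ≅ kernel e ⊞ N :=
  have h0 : (𝟙 X - e ≫ σ) ≫ e = 0 := by
    rw [Preadditive.sub_comp, Category.assoc, hσ, Category.id_comp, Category.comp_id, sub_self]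
  { hom := biprod.lift (kernel.lift e _ h0) e
    inv := biprod.desc (kernel.ι e) σ
    hom_inv_id := by rw [biprod.lift_desc, kernel.lift_ι, sub_add_cancel]
    inv_hom_id := by
      have h1 : kernel.ι e ≫ kernel.lift e _ h0 = 𝟙 _ := by
        rw [← cancel_mono (kernel.ι e)]
        simp
      have h2 : σ ≫ kernel.lift e _ h0 = 0 := by
        rw [← cancel_mono (kernel.ι e)]
        simp [reassoc_of% hσ]
      ext <;> simp [h1, h2, hσ] }

end Abelian

section Irreducible

variable {k}
variable {A : Type} [Category.{0} A] [Preadditive A] [CategoryTheory.Linear k A]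

/-- The cokernel map of an irreducible monomorphism `f` lifts along every morphism which is an
isomorphism over a full subcategory over which `f` does not split. -/
lemma Irred.exists_lift_cokernel {L M T : A ⥤ ModuleCat.{0} k} {f : L ⟶ M} [Mono f]
    (hf : Irred k f) (hM : IsLfdMod k M) (hT : IsLfdMod k T) {S : Set A}
    (hS : ∀ r, ¬ RetractionOn f S r) (v : T ⟶ cokernel f)
    (hv : ∀ s ∈ S, Function.Bijective (v.app s)) : ∃ s : M ⟶ T, s ≫ v = cokernel.π f := by
  have hnolift : ∀ θ : T ⟶ M, θ ≫ cokernel.π f ≠ v := by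
    classical
    intro θ hθ
    have hθ' : ∀ a t, (cokernel.π f).app a (θ.app a t) = v.app a t := fun a t => by
      rw [← hθ]
      rfl
    let τ (a : A) : M.obj a →ₗ[k] T.obj a :=
      if h : a ∈ S then
        (LinearEquiv.ofBijective (v.app a).hom (hv a h)).symm.toLinearMap ∘ₗ
          ((cokernel.π f).app a).hom
      else 0
    have hτ : ∀ a ∈ S, ∀ m, v.app a (τ a m) = (cokernel.π f).app a m := fun a ha m => by
      simp only [τ, dif_pos ha]
      exact LinearEquiv.apply_symm_apply (LinearEquiv.ofBijective (v.app a).hom (hv a ha)) _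
    choose ρ hρ using fun a =>
      (f.app a).hom.exists_leftInverse_of_injective (LinearMap.ker_eq_bot.2 (app_injective f a))
    have hρ' : ∀ a x, ρ a (f.app a x) = x := fun a x => LinearMap.congr_fun (hρ a) x
    have hfr : ∀ a ∈ S, ∀ m, f.app a (ρ a (m - θ.app a (τ a m))) = m - θ.app a (τ a m) := by
      intro a ha m
      obtain ⟨y, hy⟩ := exists_preimage_cokernel f (x := m - θ.app a (τ a m)) (by
        rw [map_sub, hθ', hτ a ha, sub_self])
      rw [← hy, hρ']
    refine hS (fun a => ρ a ∘ₗ (LinearMap.id - (θ.app a).hom ∘ₗ τ a))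
      ⟨fun a ha x => ?_, fun a ha b hb h m => ?_⟩
    · have h0 : τ a (f.app a x) = 0 := (hv a ha).1 (by
        rw [hτ a ha, cokernel_condition_elem, map_zero])
      change ρ a (f.app a x - θ.app a (τ a (f.app a x))) = x
      rw [h0, map_zero, sub_zero, hρ']
    · apply app_injective f b
      have h0 : τ b (M.map h m) = T.map h (τ a m) := (hv b hb).1 (by
        rw [hτ b hb, naturality_elem, naturality_elem, hτ a ha])
      change f.app b (ρ b (M.map h m - θ.app b (τ b (M.map h m)))) =
        f.app b (L.map h (ρ a (m - θ.app a (τ a m))))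
      rw [hfr b hb, naturality_elem, hfr a ha, h0, naturality_elem, map_sub]
  let f' : L ⟶ pullback (cokernel.π f) v := pullback.lift f 0 (by simp)
  rcases hf.2.2 (hM.pullback hT (cokernel.π f) v) f' (pullback.fst _ _)
    (pullback.lift_fst _ _ _) with h | h
  · exfalso
    obtain ⟨θ, hθ⟩ := exists_comp_cokernel_of_isSplitMono f v h
    exact hnolift θ hθ
  · exact ⟨section_ (pullback.fst (cokernel.π f) v) ≫ pullback.snd _ _, by
      rw [Category.assoc, ← pullback.condition, IsSplitEpi.id_assoc]⟩

/-- A split surjection from an indecomposable module is zero or injective. -/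
lemma Indec.eq_zero_or_injective {X N : A ⥤ ModuleCat.{0} k} (hX : IsLfdMod k X)
    (hi : Indec k X) (e : X ⟶ N) (he : ∀ a, Function.Surjective (e.app a)) (σ : N ⟶ X)
    (hσ : σ ≫ e = 𝟙 N) : (∀ a (n : N.obj a), n = 0) ∨ ∀ a, Function.Injective (e.app a) := by
  rcases hi.2 (hX.of_injective (kernel.ι e) (app_injective _)) (hX.of_surjective e he)
    (isoKernelBiprod e σ hσ) with h | h
  · refine Or.inr fun a => (injective_iff_map_eq_zero (e.app a).hom).2 fun x hx => ?_
    obtain ⟨y, rfl⟩ := exists_preimage_kernel e hx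
    rw [eq_zero_of_isZero h y, map_zero]
  · exact Or.inl fun a n => eq_zero_of_isZero h n

end Irreducible

section PathModules

variable {k} {Q : Type} [Quiver.{0} Q]

lemma isLfdMod_projAt (hQ : IntervalFinite Q) (x : Q) : IsLfdMod k (ProjAt k (vtx k Q x)) := by
  refine ⟨isMod_projAt _, fun y => ?_⟩
  have := hQ x y
  exact inferInstanceAs (FiniteDimensional k (Quiver.Path x y →₀ k))

lemma nonempty_path_of_ne_zero {r : ℕ} {a : Fin r → Q} {y : Q}
    {m : (⨁ fun i => ProjAt k (vtx k Q (a i))).obj (vtx k Q y)} (hm : m ≠ 0) :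
    ∃ i, Nonempty (Quiver.Path (a i) y) := by
  by_contra! h
  refine hm (biproduct_elem_ext fun i => ?_)
  have := h i
  exact Subsingleton.elim (α := Quiver.Path (a i) y →₀ k) _ _

lemma ranked_biproduct_projAt (hQ : IntervalFinite Q) {r : ℕ} (a : Fin r → Q) :
    Ranked (⨁ fun i => ProjAt k (vtx k Q (a i))) := by
  have := fun y => fun i => hQ (a i) y
  have := fun y => Fintype.ofFinite (Σ i, Quiver.Path (a i) y)
  refine ⟨fun y => (Finset.univ : Finset (Σ i, Quiver.Path (a i) y)).sup fun p => p.2.length,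
    fun {y x} α m hm => ?_⟩
  obtain ⟨i, ⟨p⟩⟩ := nonempty_path_of_ne_zero hm
  obtain ⟨q, -, hq⟩ := Finset.exists_mem_eq_sup (Finset.univ : Finset (Σ i, Quiver.Path (a i) y))
    ⟨⟨i, p⟩, Finset.mem_univ _⟩ fun p => p.2.length
  exact hq.trans_lt (Nat.lt_of_succ_le (Finset.le_sup (f := fun p : Σ i, Quiver.Path (a i) x => p.2.length)
    (Finset.mem_univ (⟨q.1, q.2.cons α⟩ : Σ i, Quiver.Path (a i) x))))

/-- The vertices lying on a path with both ends in `S`. -/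
def pathHull (S : Set Q) : Set Q :=
  {x | ∃ s ∈ S, ∃ t ∈ S, Nonempty (Quiver.Path s x) ∧ Nonempty (Quiver.Path x t)}

lemma subset_pathHull (S : Set Q) : S ⊆ pathHull S :=
  fun x hx => ⟨x, hx, x, hx, ⟨Quiver.Path.nil⟩, ⟨Quiver.Path.nil⟩⟩

lemma mem_pathHull {S : Set Q} {x y z : Q} (hx : x ∈ pathHull S) (hz : z ∈ pathHull S)
    (p : Quiver.Path x y) (q : Quiver.Path y z) : y ∈ pathHull S := by
  obtain ⟨s, hs, -, -, ⟨p'⟩, -⟩ := hx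
  obtain ⟨-, -, t, ht, -, ⟨q'⟩⟩ := hz
  exact ⟨s, hs, t, ht, ⟨p'.comp p⟩, ⟨q.comp q'⟩⟩

lemma finite_pathHull (hQ : IntervalFinite Q) {S : Set Q} (hS : S.Finite) :
    (pathHull S).Finite := by
  have h : (⋃ s ∈ S, ⋃ t ∈ S, ⋃ p : Quiver.Path s t, {x | x ∈ p.vertices}).Finite :=
    hS.biUnion fun s _ => hS.biUnion fun t _ =>
      have := hQ s t
      Set.finite_iUnion fun p => p.vertices.finite_toSet
  refine h.subset ?_
  rintro x ⟨s, hs, t, ht, ⟨p⟩, ⟨q⟩⟩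
  simp only [Set.mem_iUnion]
  refine ⟨s, hs, t, ht, p.comp q, ?_⟩
  change x ∈ (p.comp q).vertices
  rw [Quiver.Path.vertices_comp]
  exact List.mem_append_right _ q.start_mem_vertices

variable [∀ y : Q, Fintype (Σ z : Q, z ⟶ y)]

/-- A submodule of the quotient of an arrow-free module by `K.gen S` is arrow-free if it consists
of classes of elements of `K`. -/
lemma ArrowFree.of_injective_quot_gen {M N : PathCat k Q ⥤ ModuleCat.{0} k} (hM : IsMod k M)
    (hfree : ArrowFree M) (K : SubRep M) (S : Set (PathCat k Q))
    (hS : ∀ {y x : Q}, (y ⟶ x) → vtx k Q x ∈ S →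
      ∀ m ∈ K.carrier (vtx k Q y), m ∈ (K.gen S).carrier (vtx k Q y))
    (j : N ⟶ (K.gen S).quot) (hj : ∀ a, Function.Injective (j.app a))
    (hK : ∀ a n, ∃ m ∈ K.carrier a, (K.gen S).proj.app a m = j.app a n) : ArrowFree N := by
  intro x u hu p
  choose w hwK hw using fun p : (Σ z : Q, z ⟶ x) => hK (vtx k Q p.1) (u p)
  have h := hfree.mem_gen hM K S hS w hwK ((SubRep.proj_eq_zero_iff _).1 (by
    rw [map_sum, ← map_zero (j.app _).hom]
    change _ = j.app _ 0
    rw [← hu, map_sum]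
    refine Finset.sum_congr rfl fun (p : Σ z : Q, z ⟶ x) _ => ?_
    rw [naturality_elem, naturality_elem, hw])) p
  refine hj _ ?_
  rw [← hw, map_zero]
  exact (SubRep.proj_eq_zero_iff _).2 h

lemma Indec.injective_of_ne_zero {X N : PathCat k Q ⥤ ModuleCat.{0} k} (hX : IsLfdMod k X)
    (hi : Indec k X) (hN : IsMod k N) (hfree : ArrowFree N) (hrk : Ranked N) {φ : X ⟶ N}
    (hφ : φ ≠ 0) : ∀ a, Function.Injective (φ.app a) := by
  have hinj := app_injective (image.ι φ)
  have hsurj := app_surjective (factorThruImage φ)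
  have hfac : ∀ a x, (image.ι φ).app a ((factorThruImage φ).app a x) = φ.app a x := fun a x =>
    congr(($(image.fac φ)).app a x)
  obtain ⟨σ, hσ⟩ := (hfree.of_injective _ hinj).exists_section hX.1 (hN.of_injective _ hinj)
    (hrk.of_injective _ hinj) (factorThruImage φ) hsurj
  rcases hi.eq_zero_or_injective hX _ hsurj σ hσ with h | h
  · refine absurd (hom_ext_elem fun a x => ?_) hφ
    rw [← hfac, h _ ((factorThruImage φ).app a x), map_zero]
    rfl
  · intro a x y hxy
    rw [← hfac, ← hfac] at hxy
    exact h a (hinj a hxy)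

/-- A ranked arrow-free indecomposable module is generated at a single vertex. -/
lemma Indec.exists_generatedAt {X : PathCat k Q ⥤ ModuleCat.{0} k} (hX : IsLfdMod k X)
    (hi : Indec k X) (hfree : ArrowFree X) (hrk : Ranked X) :
    ∃ c : Q, GeneratedAt X {vtx k Q c} := by
  obtain ⟨rk, hrk'⟩ := id hrk
  obtain ⟨c, ⟨x, hx⟩, hmin⟩ : ∃ c : Q, (∃ x : X.obj (vtx k Q c), x ≠ 0) ∧
      ∀ y : Q, rk y < rk c → ∀ x : X.obj (vtx k Q y), x = 0 := by
    obtain ⟨c, hc, hmin⟩ := (measure rk).wf.has_min {c : Q | ∃ x : X.obj (vtx k Q c), x ≠ 0} (by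
      by_contra! h
      refine hi.1 ((IsZero.iff_id_eq_zero X).2 (hom_ext_elem fun a x => ?_))
      exact by_contra fun hx => Set.eq_empty_iff_forall_notMem.1 h a ⟨x, hx⟩)
    exact ⟨c, hc, fun y hy x => by_contra fun hx => hmin y ⟨x, hx⟩ hy⟩
  let G : SubRep X := (⊤ : SubRep X).gen {vtx k Q c}
  have hc : ∀ {z : Q}, vtx k Q z ∈ ({vtx k Q c} : Set (PathCat k Q)) → z = c := fun h => h
  have hfreeG : ArrowFree G.quot := hfree.of_injective_quot_gen hX.1 ⊤ {vtx k Q c}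
    (fun {y z} α hz m _ => by
      have hm : m = 0 := by_contra fun hm => hm (hmin y (hc hz ▸ hrk' α m hm) m)
      rw [hm]
      exact Submodule.zero_mem _)
    (𝟙 _) (fun a => Function.injective_id)
    (fun a n => (G.proj_surjective a n).imp fun m hm => ⟨SubRep.mem_top m, hm⟩)
  obtain ⟨σ, hσ⟩ := hfreeG.exists_section hX.1 (hX.1.of_surjective _ G.proj_surjective)
    (hrk.of_surjective _ G.proj_surjective) G.proj G.proj_surjective
  rcases hi.eq_zero_or_injective hX _ G.proj_surjective σ hσ with h | h
  · refine ⟨c, fun U hU a x => ?_⟩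
    exact SubRep.gen_le (fun s hs x _ => hU s hs x) a (G.proj_eq_zero_iff.1 (h a _))
  · have hxG : x ∈ G.carrier (vtx k Q c) :=
      SubRep.le_gen ⊤ (Set.mem_singleton (vtx k Q c)) (SubRep.mem_top x)
    have h0 : G.proj.app _ x = 0 := G.proj_eq_zero_iff.2 hxG
    exact absurd (h _ (h0.trans (map_zero (G.proj.app (vtx k Q c)).hom).symm)) hx

/-- Morphisms from an indecomposable module to ranked arrow-free modules are detected at a single
vertex. -/
lemma Indec.exists_vertex {X : PathCat k Q ⥤ ModuleCat.{0} k} (hX : IsLfdMod k X)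
    (hi : Indec k X) : ∃ c : Q, ∀ ⦃N : PathCat k Q ⥤ ModuleCat.{0} k⦄, IsMod k N → ArrowFree N →
      Ranked N → ∀ φ : X ⟶ N, (∀ x, φ.app (vtx k Q c) x = 0) → φ = 0 := by
  by_cases hex : ∃ N : PathCat k Q ⥤ ModuleCat.{0} k, IsMod k N ∧ ArrowFree N ∧ Ranked N ∧
      ∃ φ : X ⟶ N, φ ≠ 0
  · obtain ⟨N, hN, hfree, hrk, φ, hφ⟩ := hex
    have hinj := hi.injective_of_ne_zero hX hN hfree hrk hφ
    obtain ⟨c, hc⟩ := hi.exists_generatedAt hX (hfree.of_injective φ hinj) (hrk.of_injective φ hinj)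
    refine ⟨c, fun N' _ _ _ ψ hψ => hc.hom_ext fun s hs x => ?_⟩
    obtain rfl := Set.mem_singleton_iff.1 hs
    exact hψ x
  · have : Nonempty Q := by
      by_contra h
      refine hi.1 ((IsZero.iff_id_eq_zero X).2 (hom_ext_elem fun a => ?_))
      exact (h ⟨a⟩).elim
    exact ⟨this.some, fun N hN hfree hrk φ _ => by_contra fun h => hex ⟨N, hN, hfree, hrk, φ, h⟩⟩

end PathModules

section Presentation

variable {k} {A : Type} [Category.{0} A] [Preadditive A] [CategoryTheory.Linear k A]

/-- Let `w : P ⟶ C` be a morphism out of a finitely generated projective module generated at `S`.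
If the map to `C` from the quotient of `P` by the subfunctor generated by the kernel of `w` at `S`
has a section, then `C` is finitely presented. -/
lemma isFP_of_section {r : ℕ} {a : Fin r → A} (hP : IsLfdMod k (⨁ fun i => ProjAt k (a i)))
    {S : Set A} (hS : S.Finite) (ha : ∀ i, a i ∈ S) {C : A ⥤ ModuleCat.{0} k}
    (w : (⨁ fun i => ProjAt k (a i)) ⟶ C)
    (s : C ⟶ ((SubRep.ker w).gen S).quot)
    (hs : s ≫ ((SubRep.ker w).gen S).desc w (SubRep.gen_le_self _ S) = 𝟙 C) : IsFP k C := by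
  let K' := (SubRep.ker w).gen S
  let v := K'.desc w (SubRep.gen_le_self _ S)
  have hv : ∀ b x, v.app b (K'.proj.app b x) = w.app b x := fun b x => rfl
  have hsv : ∀ b x, v.app b (s.app b x) = x := fun b x => congr(($hs).app b x)
  have hvs : K'.proj ≫ v ≫ s = K'.proj := by
    refine (generatedAt_biproduct_projAt ha).hom_ext fun b hb x => ?_
    obtain ⟨y, hy⟩ := K'.proj_surjective b (s.app b (w.app b x))
    change s.app b (w.app b x) = K'.proj.app b x
    rw [← hy, ← sub_eq_zero, ← map_sub, K'.proj_eq_zero_iff]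
    refine SubRep.le_gen _ hb (SubRep.mem_ker.2 ?_)
    rw [map_sub, ← hv, hy, hsv, sub_self]
  have hw : Epi w := epi_of_surjective w fun b x => by
    obtain ⟨y, hy⟩ := K'.proj_surjective b (s.app b x)
    exact ⟨y, by rw [← hv, hy, hsv]⟩
  have hker : ∀ b x, w.app b x = 0 → x ∈ K'.carrier b := fun b x hx => by
    rw [← K'.proj_eq_zero_iff, ← hvs]
    change s.app b (w.app b x) = 0
    rw [hx, map_zero]
  obtain ⟨r', a', ψ, -, hψ⟩ :=
    exists_surjective_at (hP.of_injective (kernel.ι w) (app_injective _)) hS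
  refine ⟨r, a, w, hw, r', a', ψ, epi_of_surjective ψ fun b y => ?_⟩
  obtain ⟨z, hz⟩ := SubRep.gen_le (V := SubRep.range (ψ ≫ kernel.ι w)) (fun t ht x hx => by
    obtain ⟨y, rfl⟩ := exists_preimage_kernel w hx
    obtain ⟨z, rfl⟩ := hψ t ht y
    exact ⟨z, rfl⟩) b (hker b ((kernel.ι w).app b y) (kernel_condition_elem w y))
  exact ⟨z, app_injective (kernel.ι w) b hz⟩

end Presentation

section Cokernel

variable {k} {Q : Type} [Quiver.{0} Q] [∀ y : Q, Fintype (Σ z : Q, z ⟶ y)]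

/-- The cokernel of an irreducible monomorphism `f` is finitely presented if `f` does not split over
a finite convex set `S` of vertices at which all maps from the summands of its source to ranked
arrow-free modules are detected. -/
lemma isFP_cokernel (hQ : IntervalFinite Q) {L M : PathCat k Q ⥤ ModuleCat.{0} k}
    (hM : IsLfdMod k M) (f : L ⟶ M) [Mono f] (hirr : Irred k f) {n : ℕ}
    (X : Fin n → (PathCat k Q ⥤ ModuleCat.{0} k)) (e : L ≅ ⨁ X) (c : Fin n → Q)
    (hc : ∀ i, ∀ ⦃N : PathCat k Q ⥤ ModuleCat.{0} k⦄, IsMod k N → ArrowFree N → Ranked N →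
      ∀ φ : X i ⟶ N, (∀ x, φ.app (vtx k Q (c i)) x = 0) → φ = 0)
    {S : Set (PathCat k Q)} (hS : S.Finite) (hr : ∀ r, ¬ RetractionOn f S r)
    (hcS : ∀ i, vtx k Q (c i) ∈ S)
    (hconv : ∀ {x y z : Q}, vtx k Q x ∈ S → vtx k Q z ∈ S → Quiver.Path x y → Quiver.Path y z →
      vtx k Q y ∈ S)
    {r : ℕ} {a : Fin r → Q} (φ : (⨁ fun i => ProjAt k (vtx k Q (a i))) ⟶ M)
    (ha : ∀ i, vtx k Q (a i) ∈ S) (hφ : ∀ s ∈ S, Function.Surjective (φ.app s)) :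
    IsFP k (cokernel f) := by
  have hP : IsLfdMod k (⨁ fun i => ProjAt k (vtx k Q (a i))) :=
    isLfdMod_biproduct fun i => isLfdMod_projAt hQ (a i)
  let w := φ ≫ cokernel.π f
  have hw : ∀ b x, w.app b x = (cokernel.π f).app b (φ.app b x) := fun b x => rfl
  let K := SubRep.ker w
  let T := (K.gen S).quot
  let v : T ⟶ cokernel f := (K.gen S).desc w (SubRep.gen_le_self _ S)
  have hv : ∀ b x, v.app b ((K.gen S).proj.app b x) = w.app b x := fun b x => rfl
  have hvinj : ∀ s ∈ S, ∀ t : T.obj s, v.app s t = 0 → t = 0 := fun s hs t ht => by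
    obtain ⟨x, rfl⟩ := (K.gen S).proj_surjective s t
    rw [hv] at ht
    exact (K.gen S).proj_eq_zero_iff.2 (SubRep.le_gen _ hs (SubRep.mem_ker.2 ht))
  have hT : IsLfdMod k T := hP.of_surjective _ (K.gen S).proj_surjective
  obtain ⟨s, hs⟩ := hirr.exists_lift_cokernel hM hT hr v fun b hb =>
    ⟨(injective_iff_map_eq_zero (v.app b).hom).2 (hvinj b hb), fun y => by
      obtain ⟨m, rfl⟩ := app_surjective (cokernel.π f) b y
      obtain ⟨x, rfl⟩ := hφ b hb m
      exact ⟨(K.gen S).proj.app b x, rfl⟩⟩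
  have hιinj := app_injective (kernel.ι v)
  have hfree : ArrowFree (kernel v) :=
    (arrowFree_biproduct fun i => arrowFree_projAt (a i)).of_injective_quot_gen hP.1 K S
      (fun {y x} α hx m hm => by
        by_cases h0 : m = 0
        · rw [h0]
          exact Submodule.zero_mem _
        · obtain ⟨i, ⟨p⟩⟩ := nonempty_path_of_ne_zero h0
          exact SubRep.le_gen _ (hconv (ha i) hx p α.toPath) hm)
      (kernel.ι v) hιinj (fun b y => by
        obtain ⟨x, hx⟩ := (K.gen S).proj_surjective b ((kernel.ι v).app b y)
        refine ⟨x, SubRep.mem_ker.2 ?_, hx⟩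
        rw [← hv, hx, kernel_condition_elem])
  have hrk : Ranked (kernel v) :=
    ((ranked_biproduct_projAt hQ a).of_surjective _ (K.gen S).proj_surjective).of_injective
      (kernel.ι v) hιinj
  have hfsv : (f ≫ s) ≫ v = 0 := by rw [Category.assoc, hs, cokernel.condition]
  have hlift : e.inv ≫ kernel.lift v (f ≫ s) hfsv = 0 := by
    refine biproduct.hom_ext' _ _ fun i => ?_
    rw [comp_zero]
    refine hc i (hT.1.of_injective _ hιinj) hfree hrk _ fun x => ?_
    refine hιinj _ ((hvinj _ (hcS i) _ (kernel_condition_elem v _)).trans (map_zero _).symm)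
  have hfs : f ≫ s = 0 := by
    rw [← kernel.lift_ι v (f ≫ s) hfsv, ← e.hom_inv_id_assoc (kernel.lift v (f ≫ s) hfsv), hlift,
      comp_zero, zero_comp]
  refine isFP_of_section hP hS ha w (cokernel.desc f s hfs) ?_
  rw [← cancel_epi (cokernel.π f), cokernel.π_desc_assoc, Category.comp_id]
  exact hs

end Cokernel

variable (k : Type) [Field k] [IsAlgClosed k]
variable (Q : Type) [Quiver.{0} Q]

/-- For `A = kQ` with `Q` strongly locally finite: if `f : L ⟶ M` is an irreducible
monomorphism in `mod A` and `L` is a finite direct sum of indecomposable modules, then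
`coker f` is finitely presented. -/
theorem statement_7 (hQ : StronglyLocallyFinite Q)
    {L M : PathCat k Q ⥤ ModuleCat.{0} k}
    (hL : IsLfdMod k L) (hM : IsLfdMod k M) (f : L ⟶ M) (hmono : Mono f)
    (hirr : Irred k f)
    (hdec : ∃ (r : ℕ) (X : Fin r → (PathCat k Q ⥤ ModuleCat.{0} k)),
      (∀ i, IsLfdMod k (X i) ∧ Indec k (X i)) ∧ Nonempty (L ≅ ⨁ X)) :
    IsFP k (cokernel f) := by
  have := fun y : Q => (hQ.1 y).2
  have := fun y : Q => Fintype.ofFinite (Σ z : Q, z ⟶ y)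
  obtain ⟨S₀, hS₀, hr₀⟩ : ∃ S : Set (PathCat k Q), S.Finite ∧ ∀ r, ¬ RetractionOn f S r := by
    by_contra! h
    exact hirr.1 (isSplitMono_of_retractionOn hL f h)
  obtain ⟨n, X, hX, ⟨e⟩⟩ := hdec
  choose c hc using fun i => (hX i).2.exists_vertex (hX i).1
  obtain ⟨S, hS, hS₀S, hcS, hconv⟩ : ∃ S : Set (PathCat k Q), S.Finite ∧ S₀ ⊆ S ∧
      (∀ i, vtx k Q (c i) ∈ S) ∧ ∀ {x y z : Q}, vtx k Q x ∈ S → vtx k Q z ∈ S →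
        Quiver.Path x y → Quiver.Path y z → vtx k Q y ∈ S :=
    ⟨pathHull (Q := Q) (S₀ ∪ Set.range c),
      finite_pathHull hQ.2 (hS₀.union (Set.finite_range c)),
      fun x hx => subset_pathHull (Q := Q) _ (Or.inl hx),
      fun i => subset_pathHull (Q := Q) _ (Or.inr ⟨i, rfl⟩),
      fun {x y z} => mem_pathHull (Q := Q) (x := x) (y := y) (z := z)⟩
  obtain ⟨r, a, φ, ha, hφ⟩ : ∃ (r : ℕ) (a : Fin r → Q)
      (φ : (⨁ fun i => ProjAt k (vtx k Q (a i))) ⟶ M), (∀ i, vtx k Q (a i) ∈ S) ∧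
        ∀ s ∈ S, Function.Surjective (φ.app s) := exists_surjective_at hM hS
  exact isFP_cokernel hQ.2 hM f hirr X e c hc hS (fun r hr => hr₀ r (hr.mono hS₀S)) hcS
    hconv φ ha hφ

end Paper
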